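/- Let S₁, S₂, S'₁, S'₂ be finite sets of pairs of real numbers and let δ_{w1}, δ_{p1}, δ_{w2}, δ_{p2} be real numbers. If S'₁ approximates S₁ with additive error (δ_{w1}, δ_{p1}) and S'₂ approximates S₂ with additive error (δ_{w2}, δ_{p2}), then S'₁ + S'₂ approximates S₁ + S₂ with additive error (δ_{w1} + δ_{w2}, δ_{p1} + δ_{p2}), and S'₁ ⊕ S'₂ approximates S₁ ⊕ S₂ with additive error (δ_{w1} + δ_{w2}, δ_{p1} + δ_{p2}). -/

import Mathlib

open Pointwise
open scoped Classical

/-- `(w, p)` dominates `(w', p')`: `w ≤ w'`, `p ≥ p'`, at least one strict. -/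
def dominates (a b : ℝ × ℝ) : Prop :=
  a.1 ≤ b.1 ∧ b.2 ≤ a.2 ∧ (a.1 < b.1 ∨ b.2 < a.2)

/-- The `(max,+)`-convolution `X ⊕ Y`: the non-dominated tuples of the sumset `X + Y`. -/
noncomputable def maxPlusConv (X Y : Finset (ℝ × ℝ)) : Finset (ℝ × ℝ) :=
  (X + Y).filter fun t => ¬ ∃ t' ∈ X + Y, dominates t' t

/-- `S'` approximates `S` with additive error `(δw, δp)`. -/
def ApproxAddF (δw δp : ℝ) (S' S : Finset (ℝ × ℝ)) : Prop :=
  ∀ x ∈ S, ∃ y ∈ S', y.1 ≤ x.1 + δw ∧ x.2 - δp ≤ y.2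

theorem exists_mem_not_dominated (X : Finset (ℝ × ℝ)) {t : ℝ × ℝ} (ht : t ∈ X) :
    ∃ y ∈ X, (¬ ∃ z ∈ X, dominates z y) ∧ y.1 ≤ t.1 ∧ t.2 ≤ y.2 := by
  obtain ⟨y, hy, hmin⟩ := (X.filter fun y => y.1 ≤ t.1 ∧ t.2 ≤ y.2).exists_min_image
    (fun y => y.1 - y.2) ⟨t, Finset.mem_filter.2 ⟨ht, le_rfl, le_rfl⟩⟩
  obtain ⟨hyX, hw, hp⟩ := Finset.mem_filter.1 hy
  refine ⟨y, hyX, ?_, hw, hp⟩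
  rintro ⟨z, hz, hzw, hzp, hlt⟩
  have hle := hmin z (Finset.mem_filter.2 ⟨hz, hzw.trans hw, hp.trans hzp⟩)
  rcases hlt with hlt | hlt <;> linarith

theorem ApproxAddF.add {δw1 δp1 δw2 δp2 : ℝ} {S₁ S₂ S₁' S₂' : Finset (ℝ × ℝ)}
    (h1 : ApproxAddF δw1 δp1 S₁' S₁) (h2 : ApproxAddF δw2 δp2 S₂' S₂) :
    ApproxAddF (δw1 + δw2) (δp1 + δp2) (S₁' + S₂') (S₁ + S₂) := by
  intro x hx
  obtain ⟨a, ha, b, hb, rfl⟩ := Finset.mem_add.1 hx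
  obtain ⟨a', ha', haw, hap⟩ := h1 a ha
  obtain ⟨b', hb', hbw, hbp⟩ := h2 b hb
  refine ⟨a' + b', Finset.add_mem_add ha' hb', ?_, ?_⟩ <;>
    simp only [Prod.fst_add, Prod.snd_add] <;> linarith

theorem stmt_3 (δw1 δp1 δw2 δp2 : ℝ) (S₁ S₂ S₁' S₂' : Finset (ℝ × ℝ))
    (h1 : ApproxAddF δw1 δp1 S₁' S₁) (h2 : ApproxAddF δw2 δp2 S₂' S₂) :
    ApproxAddF (δw1 + δw2) (δp1 + δp2) (S₁' + S₂') (S₁ + S₂) ∧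
    ApproxAddF (δw1 + δw2) (δp1 + δp2) (maxPlusConv S₁' S₂') (maxPlusConv S₁ S₂) := by
  refine ⟨h1.add h2, fun x hx => ?_⟩
  obtain ⟨t, ht, htw, htp⟩ := h1.add h2 x (Finset.mem_filter.1 hx).1
  obtain ⟨y, hy, hnd, hyw, hyp⟩ := exists_mem_not_dominated _ ht
  exact ⟨y, Finset.mem_filter.2 ⟨hy, hnd⟩, hyw.trans htw, htp.trans hyp⟩
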